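/- Let G be an ℓ-local subgroup of S_n, let μ₀ be the uniform probability measure on G, and let K_n = #{j ∈ {2,…,n} : O_j ≠ {j}}. Then for all probability measures ν₁, ν₂ on G, W₁(ν₁,ν₂)² ≤ (ℓ² K_n / 2) · ( √H(ν₁|μ₀) + √H(ν₂|μ₀) )² and T̃₂(ν₂|ν₁) ≤ 2 ℓ² K_n · ( √H(ν₁|μ₀) + √H(ν₂|μ₀) )², where W₁ and T̃₂ are taken for the Hamming distance d_H. -/

import Mathlib

attribute [local instance] Classical.propDecidable

noncomputable section

/-- Hamming distance on permutations, as a real number. -/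
noncomputable def dH {n : ℕ} (σ τ : Equiv.Perm (Fin n)) : ℝ :=
  ((Finset.univ.filter fun i => σ i ≠ τ i).card : ℝ)

/-- Degree (cardinality of the support) of a permutation. -/
noncomputable def degree {n : ℕ} (σ : Equiv.Perm (Fin n)) : ℕ :=
  (Finset.univ.filter fun i => σ i ≠ i).card

/-- The subgroup `G_j` of elements of `G` fixing every index `> j`. -/
def Gj {n : ℕ} (G : Subgroup (Equiv.Perm (Fin n))) (j : Fin n) :
    Set (Equiv.Perm (Fin n)) :=
  {σ | σ ∈ G ∧ ∀ i : Fin n, j < i → σ i = i}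

/-- The orbit `O_j` of `j` under `G_j`. -/
def Orb {n : ℕ} (G : Subgroup (Equiv.Perm (Fin n))) (j : Fin n) : Set (Fin n) :=
  {i | ∃ σ ∈ Gj G j, σ j = i}

/-- An `ℓ`-local base of `G`. -/
def IsLocalBase {n : ℕ} (ℓ : ℕ) (G : Subgroup (Equiv.Perm (Fin n)))
    (t : Fin n → Fin n → Equiv.Perm (Fin n)) : Prop :=
  ∀ j : Fin n, (j : ℕ) ≠ 0 →
    t j j = 1 ∧ ∀ i ∈ Orb G j, i ≠ j →
      t i j ∈ Gj G j ∧ t i j i = j ∧ degree (t i j) ≤ ℓ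

/-- The map `U_T (i_2, …, i_n) = t_{i_2,2} t_{i_3,3} ⋯ t_{i_n,n}`. -/
noncomputable def UT {n : ℕ} (t : Fin n → Fin n → Equiv.Perm (Fin n))
    (i : Fin n → Fin n) : Equiv.Perm (Fin n) :=
  (((List.finRange n).drop 1).map fun j => t (i j) j).prod

/-- `μ` belongs to the class `M_T`: it is the pushforward under `U_T` of a product
of probability measures on the orbits `O_j`. -/
def MemMT {n : ℕ} (G : Subgroup (Equiv.Perm (Fin n)))
    (t : Fin n → Fin n → Equiv.Perm (Fin n)) (μ : Equiv.Perm (Fin n) → ℝ) : Prop :=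
  ∃ νh : Fin n → Fin n → ℝ,
    (∀ j : Fin n,
      (∀ i, 0 ≤ νh j i) ∧ (∀ i, i ∉ Orb G j → νh j i = 0) ∧ ∑ i, νh j i = 1) ∧
    ∀ σ, μ σ = ∑ i : Fin n → Fin n, if UT t i = σ then ∏ j, νh j (i j) else 0

/-- `K_n`, the number of indices `j ∈ {2, …, n}` with `O_j ≠ {j}`. -/
noncomputable def Kn {n : ℕ} (G : Subgroup (Equiv.Perm (Fin n))) : ℕ :=
  (Finset.univ.filter fun j : Fin n => (j : ℕ) ≠ 0 ∧ Orb G j ≠ {j}).card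

/-- `G` is an `ℓ`-local group of permutations. -/
def IsLLocal {n : ℕ} (ℓ : ℕ) (G : Subgroup (Equiv.Perm (Fin n))) : Prop :=
  ∀ σ ∈ G, ∀ i j : Fin n, σ i = j →
    ∃ τ ∈ G, {x | τ x ≠ x} ⊆ {x | σ x ≠ x} ∧ degree τ ≤ ℓ ∧ τ i = j

/-- The uniform probability measure on `G`. -/
noncomputable def unif {n : ℕ} (G : Subgroup (Equiv.Perm (Fin n))) :
    Equiv.Perm (Fin n) → ℝ :=
  fun σ => if σ ∈ G then (Nat.card G : ℝ)⁻¹ else 0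

/-- Relative entropy `H(ν | μ)` of finitely supported densities; `+∞` if `ν` is not
absolutely continuous with respect to `μ`. -/
noncomputable def relEnt {X : Type*} [Fintype X] (ν μ : X → ℝ) : ENNReal :=
  if ∀ x, μ x = 0 → ν x = 0 then
    ENNReal.ofReal (∑ x, ν x * Real.log (ν x / μ x))
  else ⊤

/-- `p` is a probability measure supported on the set `S`. -/
def IsProbOn {X : Type*} [Fintype X] (p : X → ℝ) (S : Set X) : Prop :=
  (∀ x, 0 ≤ p x) ∧ (∀ x, x ∉ S → p x = 0) ∧ ∑ x, p x = 1

/-- The `W₁` Wasserstein distance for the cost `d`. -/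
noncomputable def W1 {X : Type*} [Fintype X] (d : X → X → ℝ) (ν₁ ν₂ : X → ℝ) : ℝ :=
  sInf {w | ∃ π : X × X → ℝ,
    (∀ q, 0 ≤ π q) ∧ (∀ x, ∑ y, π (x, y) = ν₁ x) ∧ (∀ y, ∑ x, π (x, y) = ν₂ y) ∧
    w = ∑ q : X × X, d q.1 q.2 * π q}

/-- The weak transport cost `̃T₂(ν₂ | ν₁)` for the cost `d` (kernel formulation,
`π(x, y) = ν₁(x) p_x(y)`). -/
noncomputable def tT2 {X : Type*} [Fintype X] (d : X → X → ℝ) (ν₁ ν₂ : X → ℝ) : ℝ :=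
  sInf {w | ∃ p : X → X → ℝ,
    (∀ x y, 0 ≤ p x y) ∧ (∀ x, ∑ y, p x y = 1) ∧ (∀ y, ∑ x, ν₁ x * p x y = ν₂ y) ∧
    w = ∑ x, ν₁ x * (∑ y, p x y * d x y) ^ 2}

/-- The `r`-th power of the transport cost of some transport kernel from `α` to `β` is at
most `w ^ r`: the kernel averages the cost `d` at each source point, and these averages are
measured in `L^r(α)`. -/
def HasTransport {X : Type*} [Fintype X] (r : ℕ) (d : X → X → ℝ) (α β : X → ℝ) (w : ℝ) : Prop :=
  ∃ p : X → X → ℝ, (∀ x y, 0 ≤ p x y) ∧ (∀ x, ∑ y, p x y = 1) ∧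
    (∀ y, ∑ x, α x * p x y = β y) ∧ ∑ x, α x * (∑ y, p x y * d x y) ^ r ≤ w ^ r

/-- Entropy relative to the uniform measure on a finite type. -/
def entUnif {X : Type*} [Fintype X] (ν : X → ℝ) : ℝ :=
  ∑ x, ν x * Real.log (ν x * Fintype.card X)

/-- The uniform density on a finite type. -/
def unifDensity (X : Type*) [Fintype X] : X → ℝ := fun _ => (Fintype.card X : ℝ)⁻¹

/-- The transport-entropy inequality with constant `C` between any probability density and the
uniform one, in both directions. -/
def TransportEntropy (r : ℕ) (X : Type*) [Fintype X] (d : X → X → ℝ) (C : ℝ) : Prop :=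
  ∀ ν : X → ℝ, (∀ x, 0 ≤ ν x) → ∑ x, ν x = 1 →
    HasTransport r d ν (unifDensity X) (√(C * entUnif ν)) ∧
    HasTransport r d (unifDensity X) ν (√(C * entUnif ν))

/-- The sharp one-step constants: `1 / 2` for `r = 1` (Pinsker) and `2` for `r = 2`. -/
def stepConst (r : ℕ) : ℝ := if r = 1 then 1 / 2 else 2

theorem stepConst_nonneg (r : ℕ) : 0 ≤ stepConst r := by
  unfold stepConst; split_ifs <;> norm_num

theorem div_le_log_of_pos {u : ℝ} (hu : 0 < u) :
    (5 * u ^ 2 - 4 * u - 1) / (2 * u ^ 2 + 4 * u) ≤ Real.log u := by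
  set g : ℝ → ℝ := fun u => Real.log u - (5 * u ^ 2 - 4 * u - 1) / (2 * u ^ 2 + 4 * u) with hg
  have hd : ∀ x : ℝ, 0 < x → HasDerivAt g ((x - 1) ^ 3 / (x ^ 2 * (x + 2) ^ 2)) x := by
    intro x hx
    have h2 : 2 * x ^ 2 + 4 * x ≠ 0 := by positivity
    have h1 : HasDerivAt (fun u : ℝ => 5 * u ^ 2 - 4 * u - 1) (10 * x - 4) x := by
      have := (((hasDerivAt_pow 2 x).const_mul 5).sub ((hasDerivAt_id x).const_mul 4)).sub_const 1
      refine this.congr_deriv ?_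
      norm_num; ring
    have h3 : HasDerivAt (fun u : ℝ => 2 * u ^ 2 + 4 * u) (4 * x + 4) x := by
      have := ((hasDerivAt_pow 2 x).const_mul 2).add ((hasDerivAt_id x).const_mul 4)
      refine this.congr_deriv ?_
      norm_num; ring
    refine ((Real.hasDerivAt_log hx.ne').sub (h1.div h3 h2)).congr_deriv ?_
    field_simp
    ring
  have h1 : g 1 = 0 := by simp [hg]; norm_num
  suffices 0 ≤ g u by simp only [hg] at this; linarith
  rw [← h1]
  rcases le_total 1 u with h | h
  · refine monotoneOn_of_deriv_nonneg (convex_Icc 1 u)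
      (fun x hx => (hd x (by linarith [hx.1])).continuousAt.continuousWithinAt)
      (fun x hx => ?_) (fun x hx => ?_) (Set.left_mem_Icc.2 h) (Set.right_mem_Icc.2 h) h
    · rw [interior_Icc] at hx
      exact (hd x (by linarith [hx.1])).differentiableAt.differentiableWithinAt
    · rw [interior_Icc] at hx
      rw [(hd x (by linarith [hx.1])).deriv]
      have : 0 ≤ x - 1 := by linarith [hx.1]
      positivity
  · refine antitoneOn_of_deriv_nonpos (convex_Icc u 1)
      (fun x hx => (hd x (by linarith [hx.1])).continuousAt.continuousWithinAt)
      (fun x hx => ?_) (fun x hx => ?_) (Set.left_mem_Icc.2 h) (Set.right_mem_Icc.2 h) h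
    · rw [interior_Icc] at hx
      exact (hd x (by linarith [hx.1])).differentiableAt.differentiableWithinAt
    · rw [interior_Icc] at hx
      rw [(hd x (by linarith [hx.1])).deriv]
      have : x - 1 ≤ 0 := by linarith [hx.2]
      exact div_nonpos_of_nonpos_of_nonneg (Odd.pow_nonpos (by decide) this) (by positivity)

theorem sq_le_mul_log {x m : ℝ} (hx : 0 ≤ x) (hm : 0 < m) :
    3 * (x - m) ^ 2 ≤ 2 * (x + 2 * m) * (x * Real.log (x * m⁻¹) - x + m) := by
  rcases hx.eq_or_lt with rfl | hx
  · simp; nlinarith [sq_nonneg m]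
  · have h := div_le_log_of_pos (div_pos hx hm)
    have e : (5 * (x / m) ^ 2 - 4 * (x / m) - 1) / (2 * (x / m) ^ 2 + 4 * (x / m)) =
        (5 * x ^ 2 - 4 * x * m - m ^ 2) / (2 * x * (x + 2 * m)) := by
      field_simp
      ring
    rw [e, div_le_iff₀ (by positivity)] at h
    rw [← div_eq_mul_inv]
    nlinarith

section Variation

variable {I : Type*} [Fintype I]

theorem card_pos_of_sum_eq_one {a : I → ℝ} (ha1 : ∑ i, a i = 1) :
    (0 : ℝ) < Fintype.card I := by
  rcases isEmpty_or_nonempty I with h | h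
  · simp at ha1
  · exact_mod_cast Fintype.card_pos

theorem sum_unifDensity {a : I → ℝ} (ha1 : ∑ i, a i = 1) :
    ∑ i, unifDensity I i = 1 := by
  simp [unifDensity, (card_pos_of_sum_eq_one ha1).ne']

theorem sum_gap_entUnif {a : I → ℝ} (ha1 : ∑ i, a i = 1) :
    ∑ i, (a i * Real.log (a i * (unifDensity I i)⁻¹) - a i + unifDensity I i) = entUnif a := by
  have := card_pos_of_sum_eq_one ha1
  rw [Finset.sum_add_distrib, Finset.sum_sub_distrib, ha1, sum_unifDensity ha1]
  simp [entUnif, unifDensity]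

theorem gap_nonneg {x m : ℝ} (hx : 0 ≤ x) (hm : 0 < m) :
    0 ≤ x * Real.log (x * m⁻¹) - x + m := by
  have h := sq_le_mul_log hx hm
  by_contra! hc
  nlinarith [sq_nonneg (x - m), mul_neg_of_pos_of_neg (by positivity : 0 < 2 * (x + 2 * m)) hc]

theorem unifDensity_pos {a : I → ℝ} (ha1 : ∑ i, a i = 1) (i : I) : 0 < unifDensity I i :=
  inv_pos.2 (card_pos_of_sum_eq_one ha1)

theorem entUnif_nonneg {a : I → ℝ} (ha : ∀ i, 0 ≤ a i) (ha1 : ∑ i, a i = 1) :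
    0 ≤ entUnif a := by
  rw [← sum_gap_entUnif ha1]
  exact Finset.sum_nonneg fun i _ => gap_nonneg (ha i) (unifDensity_pos ha1 i)

/-- Pinsker's inequality relative to the uniform density. -/
theorem pinsker {a : I → ℝ} (ha : ∀ i, 0 ≤ a i) (ha1 : ∑ i, a i = 1) :
    (∑ i, |a i - unifDensity I i|) ^ 2 ≤ 2 * entUnif a := by
  have hu := unifDensity_pos ha1
  have h := Finset.sum_sq_le_sum_mul_sum_of_sq_le_mul Finset.univ
    (r := fun i => |a i - unifDensity I i|)
    (f := fun i => 2 / 3 * (a i + 2 * unifDensity I i))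
    (g := fun i => a i * Real.log (a i * (unifDensity I i)⁻¹) - a i + unifDensity I i)
    (fun i _ => by have := ha i; have := hu i; positivity)
    (fun i _ => gap_nonneg (ha i) (hu i))
    (fun i _ => by
      have := sq_le_mul_log (ha i) (hu i)
      rw [sq_abs]; linarith)
  refine h.trans (le_of_eq ?_)
  rw [sum_gap_entUnif ha1, ← Finset.mul_sum, Finset.sum_add_distrib, ← Finset.mul_sum, ha1,
    sum_unifDensity ha1]
  ring

/-- A kernel realizing the total variation distance. -/
theorem exists_variation_kernel {a b : I → ℝ} (ha : ∀ i, 0 ≤ a i) (hb : ∀ i, 0 ≤ b i)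
    (hab : ∑ i, a i = ∑ i, b i) :
    ∃ q : I → I → ℝ, (∀ i j, 0 ≤ q i j) ∧ (∀ i, ∑ j, q i j = 1) ∧
      (∀ j, ∑ i, a i * q i j = b j) ∧ ∀ i, 1 - q i i ≤ max (a i - b i) 0 / a i := by
  set D : ℝ := ∑ i, max (b i - a i) 0 with hD
  have hD' : ∑ i, max (a i - b i) 0 = D := by
    have : ∑ i, (max (a i - b i) 0 - max (b i - a i) 0) = ∑ i, (a i - b i) := by
      refine Finset.sum_congr rfl fun i _ => ?_
      rcases le_total (a i) (b i) with h | h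
      · rw [max_eq_right (by linarith), max_eq_left (by linarith)]; ring
      · rw [max_eq_left (by linarith), max_eq_right (by linarith)]; ring
    rw [Finset.sum_sub_distrib, Finset.sum_sub_distrib] at this
    linarith
  have hDa : ∀ i, max (a i - b i) 0 * (D / D) = max (a i - b i) 0 := by
    intro i
    by_cases h : D = 0
    · rw [h] at hD'
      rw [(Finset.sum_eq_zero_iff_of_nonneg (fun i _ => le_max_right _ _)).1 hD' i
        (Finset.mem_univ i)]
      simp
    · rw [div_self h, mul_one]
  have hDb : ∀ i, max (b i - a i) 0 * (D / D) = max (b i - a i) 0 := by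
    intro i
    by_cases h : D = 0
    · rw [(Finset.sum_eq_zero_iff_of_nonneg (fun i _ => le_max_right _ _)).1 (hD.symm.trans h) i
        (Finset.mem_univ i)]
      simp
    · rw [div_self h, mul_one]
  have hD0 : 0 ≤ D := Finset.sum_nonneg fun i _ => le_max_right _ _
  have hmin : ∀ x y : ℝ, min x y + max (x - y) 0 = x := by
    intro x y
    rcases le_total x y with h | h
    · rw [min_eq_left h, max_eq_right (by linarith)]; ring
    · rw [min_eq_right h, max_eq_left (by linarith)]; ring
  let π : I → I → ℝ := fun i j =>
    (if i = j then min (a i) (b i) else 0) + max (a i - b i) 0 * (max (b j - a j) 0 / D)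
  have hπ0 : ∀ i j, 0 ≤ π i j := by
    intro i j
    have h1 : 0 ≤ min (a i) (b i) := le_min (ha i) (hb i)
    have h2 : 0 ≤ max (a i - b i) 0 := le_max_right _ _
    have h3 : 0 ≤ max (b j - a j) 0 := le_max_right _ _
    simp only [π]
    split_ifs <;> positivity
  have hrow : ∀ i, ∑ j, π i j = a i := by
    intro i
    simp only [π]
    rw [Finset.sum_add_distrib, ← Finset.mul_sum, ← Finset.sum_div, ← hD, hDa]
    simp [hmin]
  have hcol : ∀ j, ∑ i, π i j = b j := by
    intro j
    simp only [π]
    rw [Finset.sum_add_distrib, ← Finset.sum_mul, hD', mul_div_assoc', mul_comm D,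
      ← mul_div_assoc', hDb]
    simp only [Finset.sum_ite_eq', Finset.mem_univ, if_true]
    rw [min_comm, hmin]
  have hzero : ∀ i, a i = 0 → ∀ j, π i j = 0 := fun i hi j =>
    (Finset.sum_eq_zero_iff_of_nonneg (fun j _ => hπ0 i j)).1 ((hrow i).trans hi) j
      (Finset.mem_univ j)
  refine ⟨fun i j => if a i = 0 then (if i = j then 1 else 0) else π i j / a i, ?_, ?_, ?_, ?_⟩
  · intro i j
    have := ha i; have := hπ0 i j
    dsimp only
    split_ifs <;> positivity
  · intro i
    by_cases h : a i = 0
    · simp [h]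
    · simp only [h, if_false]
      rw [← Finset.sum_div, hrow, div_self h]
  · intro j
    rw [← hcol j]
    refine Finset.sum_congr rfl fun i _ => ?_
    by_cases h : a i = 0
    · simp [h, hzero i h j]
    · simp only [h, if_false]
      field_simp
  · intro i
    by_cases h : a i = 0
    · simp [h]
    · have hi : 0 < a i := lt_of_le_of_ne (ha i) (Ne.symm h)
      have h2 : 0 ≤ max (a i - b i) 0 := le_max_right _ _
      have h3 : 0 ≤ max (b i - a i) 0 := le_max_right _ _
      have h4 : min (a i) (b i) ≤ π i i := by
        simp only [π, if_true]
        have : 0 ≤ max (a i - b i) 0 * (max (b i - a i) 0 / D) := by positivity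
        linarith
      simp only [h, if_false]
      rw [one_sub_div h]
      gcongr
      linarith [hmin (a i) (b i)]

theorem sum_pos_part_le {a b : I → ℝ} (hab : ∑ i, a i = ∑ i, b i) :
    2 * ∑ i, max (a i - b i) 0 = ∑ i, |a i - b i| := by
  have : ∑ i, (2 * max (a i - b i) 0 - |a i - b i|) = ∑ i, (a i - b i) := by
    refine Finset.sum_congr rfl fun i _ => ?_
    rcases le_total (a i) (b i) with h | h
    · rw [max_eq_right (by linarith), abs_of_nonpos (by linarith)]; ring
    · rw [max_eq_left (by linarith), abs_of_nonneg (by linarith)]; ring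
  rw [Finset.sum_sub_distrib, Finset.sum_sub_distrib, ← Finset.mul_sum] at this
  linarith

theorem sum_variation_le {r : ℕ} (hr : r = 1 ∨ r = 2) {a b ν : I → ℝ}
    (ha : ∀ i, 0 ≤ a i) (hν : ∀ i, 0 ≤ ν i) (hν1 : ∑ i, ν i = 1)
    (hab : a = ν ∧ b = unifDensity I ∨ a = unifDensity I ∧ b = ν) :
    ∑ i, a i * (max (a i - b i) 0 / a i) ^ r ≤ √(stepConst r * entUnif ν) ^ r := by
  have hu := unifDensity_pos hν1
  have hE := entUnif_nonneg hν hν1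
  have hpoint : ∀ i, a i * (max (a i - b i) 0 / a i) = max (a i - b i) 0 := by
    intro i
    have hb : 0 ≤ b i := by
      rcases hab with ⟨-, rfl⟩ | ⟨-, rfl⟩
      · exact (hu i).le
      · exact hν i
    rcases (ha i).eq_or_lt with h | h
    · rw [← h]; simp [hb]
    · field_simp
  rcases hr with rfl | rfl
  · simp only [pow_one, hpoint, stepConst, if_true]
    apply Real.le_sqrt_of_sq_le
    have hsum : ∑ i, a i = ∑ i, b i := by
      rcases hab with ⟨rfl, rfl⟩ | ⟨rfl, rfl⟩ <;> rw [hν1, sum_unifDensity hν1]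
    have h2 : ∑ i, |a i - b i| = ∑ i, |ν i - unifDensity I i| := by
      rcases hab with ⟨rfl, rfl⟩ | ⟨rfl, rfl⟩
      · rfl
      · exact Finset.sum_congr rfl fun i _ => abs_sub_comm _ _
    have h3 := pinsker hν hν1
    rw [← h2, ← sum_pos_part_le hsum] at h3
    linarith
  · rw [Real.sq_sqrt (mul_nonneg (stepConst_nonneg _) hE), ← sum_gap_entUnif hν1, Finset.mul_sum]
    refine Finset.sum_le_sum fun i _ => ?_
    have hg := gap_nonneg (hν i) (hu i)
    have hs := sq_le_mul_log (hν i) (hu i)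
    have hui := hu i
    have hνi := hν i
    simp only [stepConst]
    norm_num
    set g := ν i * Real.log (ν i * (unifDensity I i)⁻¹) - ν i + unifDensity I i
    rcases le_total (a i) (b i) with h | h
    · rw [max_eq_right (by linarith)]
      simp [hg]
    · rcases (ha i).eq_or_lt with h0 | h0
      · rw [← h0]; simp [hg]
      rw [max_eq_left (by linarith), div_pow, mul_div_assoc', div_le_iff₀ (by positivity)]
      rcases hab with ⟨rfl, rfl⟩ | ⟨rfl, rfl⟩
      · have : 3 * (a i - unifDensity I i) ^ 2 ≤ 3 * (2 * a i * g) := by nlinarith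
        nlinarith
      · have : 3 * (b i - unifDensity I i) ^ 2 ≤ 3 * (2 * unifDensity I i * g) := by nlinarith
        nlinarith

end Variation

section Transport

variable {X : Type*} [Fintype X]

theorem sum_mul_add_pow_le {r : ℕ} (hr : r = 1 ∨ r = 2) {α f g : X → ℝ} {v w : ℝ}
    (hα : ∀ x, 0 ≤ α x) (hv : 0 ≤ v) (hw : 0 ≤ w)
    (hf : ∑ x, α x * f x ^ r ≤ v ^ r) (hg : ∑ x, α x * g x ^ r ≤ w ^ r) :
    ∑ x, α x * (f x + g x) ^ r ≤ (v + w) ^ r := by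
  rcases hr with rfl | rfl
  · simp only [pow_one, mul_add, Finset.sum_add_distrib] at *
    linarith
  · have hcs := Finset.sum_sq_le_sum_mul_sum_of_sq_le_mul Finset.univ
      (r := fun x => α x * (f x * g x)) (f := fun x => α x * f x ^ 2)
      (g := fun x => α x * g x ^ 2)
      (fun x _ => mul_nonneg (hα x) (sq_nonneg _)) (fun x _ => mul_nonneg (hα x) (sq_nonneg _))
      (fun x _ => le_of_eq (by ring))
    have hfg : ∑ x, α x * (f x * g x) ≤ v * w := by
      refine le_of_sq_le_sq (hcs.trans ?_) (mul_nonneg hv hw)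
      rw [mul_pow]
      exact mul_le_mul hf hg
        (Finset.sum_nonneg fun x _ => mul_nonneg (hα x) (sq_nonneg _)) (sq_nonneg _)
    have e : ∑ x, α x * (f x + g x) ^ 2 =
        ∑ x, α x * f x ^ 2 + 2 * ∑ x, α x * (f x * g x) + ∑ x, α x * g x ^ 2 := by
      rw [Finset.mul_sum, ← Finset.sum_add_distrib, ← Finset.sum_add_distrib]
      exact Finset.sum_congr rfl fun x _ => by ring
    rw [e]
    nlinarith

theorem HasTransport.mono {r : ℕ} {d : X → X → ℝ} {α β : X → ℝ} {v w : ℝ}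
    (h : HasTransport r d α β v) (hv : 0 ≤ v) (hvw : v ≤ w) : HasTransport r d α β w := by
  obtain ⟨p, h0, h1, h2, h3⟩ := h
  exact ⟨p, h0, h1, h2, h3.trans (pow_le_pow_left₀ hv hvw r)⟩

/-- The triangle inequality for transport costs. -/
theorem HasTransport.trans {r : ℕ} (hr : r = 1 ∨ r = 2) {d : X → X → ℝ}
    (hd : ∀ x y, 0 ≤ d x y) (hd' : ∀ x y z, d x z ≤ d x y + d y z) {α β γ : X → ℝ} {v w : ℝ}
    (hα : ∀ x, 0 ≤ α x) (hv : 0 ≤ v) (hw : 0 ≤ w)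
    (h : HasTransport r d α β v) (h' : HasTransport r d β γ w) :
    HasTransport r d α γ (v + w) := by
  obtain ⟨p, p0, p1, p2, p3⟩ := h
  obtain ⟨q, q0, q1, q2, q3⟩ := h'
  have hg0 : ∀ y, 0 ≤ ∑ z, q y z * d y z := fun y =>
    Finset.sum_nonneg fun z _ => mul_nonneg (q0 y z) (hd y z)
  refine ⟨fun x z => ∑ y, p x y * q y z,
    fun x z => Finset.sum_nonneg fun y _ => mul_nonneg (p0 x y) (q0 y z), fun x => ?_,
    fun z => ?_, ?_⟩
  · rw [Finset.sum_comm]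
    simp only [← Finset.mul_sum, q1, mul_one, p1]
  · simp only [Finset.mul_sum]
    rw [Finset.sum_comm, ← q2 z]
    refine Finset.sum_congr rfl fun y _ => ?_
    rw [← p2 y, Finset.sum_mul]
    exact Finset.sum_congr rfl fun x _ => by ring
  · have hJ : ∑ x, α x * (∑ y, p x y * ∑ z, q y z * d y z) ^ r ≤ w ^ r := by
      refine le_trans ?_ q3
      calc _ ≤ ∑ x, α x * ∑ y, p x y * (∑ z, q y z * d y z) ^ r :=
            Finset.sum_le_sum fun x _ => mul_le_mul_of_nonneg_left
              (Real.pow_arith_mean_le_arith_mean_pow _ _ _ (fun y _ => p0 x y) (p1 x)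
                (fun y _ => hg0 y) r) (hα x)
        _ = _ := by
            simp_rw [Finset.mul_sum Finset.univ _ (α _)]
            rw [Finset.sum_comm]
            refine Finset.sum_congr rfl fun y _ => ?_
            rw [← p2 y, Finset.sum_mul]
            exact Finset.sum_congr rfl fun x _ => by ring
    refine le_trans ?_ (sum_mul_add_pow_le hr hα hv hw p3 hJ)
    refine Finset.sum_le_sum fun x _ => mul_le_mul_of_nonneg_left (pow_le_pow_left₀ ?_ ?_ r) (hα x)
    · exact Finset.sum_nonneg fun z _ => mul_nonneg
        (Finset.sum_nonneg fun y _ => mul_nonneg (p0 x y) (q0 y z)) (hd x z)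
    · have e : ∑ y, p x y * d x y = ∑ y, ∑ z, p x y * q y z * d x y := by
        refine Finset.sum_congr rfl fun y _ => ?_
        rw [← Finset.sum_mul, ← Finset.mul_sum, q1, mul_one]
      simp only [Finset.sum_mul]
      rw [Finset.sum_comm, e, ← Finset.sum_add_distrib]
      refine Finset.sum_le_sum fun y _ => ?_
      rw [Finset.mul_sum, ← Finset.sum_add_distrib]
      refine Finset.sum_le_sum fun z _ => ?_
      have := mul_le_mul_of_nonneg_left (hd' x y z) (mul_nonneg (p0 x y) (q0 y z))
      linarith

theorem HasTransport.of_equiv {Y : Type*} [Fintype Y] (e : X ≃ Y) {r : ℕ} {d : Y → Y → ℝ}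
    {α β : Y → ℝ} {w : ℝ}
    (h : HasTransport r (fun x y => d (e x) (e y)) (α ∘ e) (β ∘ e) w) :
    HasTransport r d α β w := by
  obtain ⟨p, h0, h1, h2, h3⟩ := h
  refine ⟨fun x y => p (e.symm x) (e.symm y), fun x y => h0 _ _, fun x => ?_, fun y => ?_, ?_⟩
  · rw [← h1 (e.symm x)]
    exact e.symm.sum_comp (fun y => p (e.symm x) y)
  · rw [← e.sum_comp]
    simpa using h2 (e.symm y)
  · rw [← e.sum_comp]
    refine le_trans (le_of_eq (Finset.sum_congr rfl fun x _ => ?_)) h3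
    rw [← e.sum_comp]
    simp

variable {I : Type*} [Fintype I]

/-- Transport kernels between the fibres glue to a transport kernel of the mixtures. -/
theorem HasTransport.fiber {r : ℕ} {dX : X → X → ℝ} {d : I × X → I × X → ℝ}
    (hd : ∀ y z, 0 ≤ d y z) (hdX : ∀ i x x', d (i, x) (i, x') ≤ dX x x')
    {a : I → ℝ} (ha : ∀ i, 0 ≤ a i) {α β : I → X → ℝ} (hα : ∀ i x, 0 ≤ α i x) {w : I → ℝ} {W : ℝ}
    (h : ∀ i, HasTransport r dX (α i) (β i) (w i)) (hW : ∑ i, a i * w i ^ r ≤ W ^ r) :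
    HasTransport r d (fun y => a y.1 * α y.1 y.2) (fun y => a y.1 * β y.1 y.2) W := by
  choose p p0 p1 p2 p3 using h
  refine ⟨fun y z => if y.1 = z.1 then p y.1 y.2 z.2 else 0, fun y z => ?_, fun y => ?_,
    fun z => ?_, le_trans ?_ hW⟩
  · dsimp only
    split_ifs
    exacts [p0 _ _ _, le_rfl]
  · rw [Fintype.sum_prod_type, Finset.sum_comm]
    simp [p1]
  · rw [Fintype.sum_prod_type, Finset.sum_comm]
    simp only [mul_ite, mul_zero, Finset.sum_ite_eq', Finset.mem_univ, if_true]
    rw [← p2, Finset.mul_sum]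
    exact Finset.sum_congr rfl fun x _ => by ring
  · rw [Fintype.sum_prod_type]
    refine Finset.sum_le_sum fun i _ => ?_
    refine le_trans ?_ (mul_le_mul_of_nonneg_left (p3 i) (ha i))
    rw [Finset.mul_sum]
    refine Finset.sum_le_sum fun x _ => ?_
    rw [← mul_assoc]
    refine mul_le_mul_of_nonneg_left ?_ (mul_nonneg (ha i) (hα i x))
    rw [Fintype.sum_prod_type, Finset.sum_comm]
    simp only [ite_mul, zero_mul, Finset.sum_ite_eq, Finset.mem_univ, if_true]
    exact pow_le_pow_left₀ (Finset.sum_nonneg fun x' _ => mul_nonneg (p0 _ _ _) (hd _ _))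
      (Finset.sum_le_sum fun x' _ => mul_le_mul_of_nonneg_left (hdX i x x') (p0 _ _ _)) r

/-- Transport between two mixtures of uniform fibres that differ by bijections of bounded
displacement. -/
theorem HasTransport.base {r : ℕ} (hr : r = 1 ∨ r = 2) {d : I × X → I × X → ℝ}
    (hd : ∀ y z, 0 ≤ d y z) (hd0 : ∀ y, d y y = 0) {L : ℝ} (hL : 0 ≤ L)
    (hB : ∀ i j, ∃ b : X ≃ X, ∀ x, d (i, x) (j, b x) ≤ L)
    {a b ν : I → ℝ} (hν : ∀ i, 0 ≤ ν i) (hν1 : ∑ i, ν i = 1) {u : ℝ} (hu : 0 ≤ u)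
    (hX : Fintype.card X * u = 1)
    (hab : a = ν ∧ b = unifDensity I ∨ a = unifDensity I ∧ b = ν) :
    HasTransport r d (fun y => a y.1 * u) (fun y => b y.1 * u)
      (L * √(stepConst r * entUnif ν)) := by
  have hun := unifDensity_pos hν1
  have ha : ∀ i, 0 ≤ a i := by
    rcases hab with ⟨rfl, -⟩ | ⟨rfl, -⟩
    exacts [hν, fun i => (hun i).le]
  have hb : ∀ i, 0 ≤ b i := by
    rcases hab with ⟨-, rfl⟩ | ⟨-, rfl⟩
    exacts [fun i => (hun i).le, hν]
  have hsum : ∑ i, a i = ∑ i, b i := by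
    rcases hab with ⟨rfl, rfl⟩ | ⟨rfl, rfl⟩ <;> rw [hν1, sum_unifDensity hν1]
  obtain ⟨q, q0, q1, q2, q3⟩ := exists_variation_kernel ha hb hsum
  have hB' : ∀ i j, ∃ b : X ≃ X, ∀ x, d (i, x) (j, b x) ≤ if i = j then 0 else L := by
    intro i j
    by_cases h : i = j
    · subst h
      exact ⟨Equiv.refl X, fun x => by simp [hd0]⟩
    · simpa [h] using hB i j
  choose B hB using hB'
  refine ⟨fun y z => if z.2 = B y.1 z.1 y.2 then q y.1 z.1 else 0, fun y z => ?_, fun y => ?_,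
    fun z => ?_, ?_⟩
  · dsimp only
    split_ifs
    exacts [q0 _ _, le_rfl]
  · rw [Fintype.sum_prod_type]
    simp [q1]
  · dsimp only
    rw [Fintype.sum_prod_type, ← q2, Finset.sum_mul]
    refine Finset.sum_congr rfl fun i _ => ?_
    have : ∀ x, (z.2 = B i z.1 x) = ((B i z.1).symm z.2 = x) := fun x => by
      rw [Equiv.symm_apply_eq]
    simp only [this, mul_ite, mul_zero, Finset.sum_ite_eq, Finset.mem_univ, if_true]
    ring
  · have hv := sum_variation_le hr ha hν hν1 hab
    rw [mul_pow]
    refine le_trans ?_ (mul_le_mul_of_nonneg_left hv (pow_nonneg hL r))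
    rw [Fintype.sum_prod_type, Finset.mul_sum]
    refine Finset.sum_le_sum fun i _ => ?_
    have hle : ∀ x, a i * u * (∑ z : I × X, (if z.2 = B i z.1 x then q i z.1 else 0) *
        d (i, x) z) ^ r ≤ a i * u * (L * (max (a i - b i) 0 / a i)) ^ r := by
      intro x
      refine mul_le_mul_of_nonneg_left (pow_le_pow_left₀ ?_ ?_ r) (mul_nonneg (ha i) hu)
      · refine Finset.sum_nonneg fun z _ => mul_nonneg ?_ (hd _ _)
        split_ifs
        exacts [q0 _ _, le_rfl]
      · rw [Fintype.sum_prod_type]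
        simp only [ite_mul, zero_mul, Finset.sum_ite_eq', Finset.mem_univ, if_true]
        calc ∑ j, q i j * d (i, x) (j, B i j x)
            ≤ ∑ j, q i j * (if i = j then 0 else L) :=
              Finset.sum_le_sum fun j _ => mul_le_mul_of_nonneg_left (hB i j x) (q0 i j)
          _ = ∑ j, (L * q i j - if i = j then L * q i j else 0) :=
              Finset.sum_congr rfl fun j _ => by split_ifs <;> ring
          _ = L * (1 - q i i) := by
              rw [Finset.sum_sub_distrib, ← Finset.mul_sum, q1]
              simp; ring
          _ ≤ _ := mul_le_mul_of_nonneg_left (q3 i) hL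
    refine (Finset.sum_le_sum fun x _ => hle x).trans (le_of_eq ?_)
    rw [Finset.sum_const, Finset.card_univ, nsmul_eq_mul, mul_pow]
    linear_combination (a i * L ^ r * (max (a i - b i) 0 / a i) ^ r) * hX

theorem sqrt_mul_add_sqrt_mul_le {A B C D : ℝ} (hA : 0 ≤ A) (hB : 0 ≤ B) (hC : 0 ≤ C)
    (hD : 0 ≤ D) : √(C * A) + √(D * B) ≤ √((C + D) * (A + B)) := by
  apply Real.le_sqrt_of_sq_le
  have h1 := Real.sq_sqrt (mul_nonneg hC hA)
  have h2 := Real.sq_sqrt (mul_nonneg hD hB)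
  have h3 : √(C * A) * √(D * B) = √(C * B) * √(D * A) := by
    rw [← Real.sqrt_mul (mul_nonneg hC hA), ← Real.sqrt_mul (mul_nonneg hC hB)]
    congr 1; ring
  have h4 := Real.sq_sqrt (mul_nonneg hC hB)
  have h5 := Real.sq_sqrt (mul_nonneg hD hA)
  nlinarith [sq_nonneg (√(C * B) - √(D * A))]

theorem sum_mul_sqrt_pow_le {r : ℕ} (hr : r = 1 ∨ r = 2) {a h : I → ℝ} (ha : ∀ i, 0 ≤ a i)
    (ha1 : ∑ i, a i = 1) (hh : ∀ i, 0 ≤ h i) :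
    ∑ i, a i * √(h i) ^ r ≤ √(∑ i, a i * h i) ^ r := by
  rcases hr with rfl | rfl
  · simp only [pow_one]
    apply Real.le_sqrt_of_sq_le
    refine (Real.pow_arith_mean_le_arith_mean_pow _ _ _ (fun i _ => ha i) ha1
      (fun i _ => Real.sqrt_nonneg _) 2).trans (le_of_eq ?_)
    simp [Real.sq_sqrt (hh _)]
  · rw [Real.sq_sqrt (Finset.sum_nonneg fun i _ => mul_nonneg (ha i) (hh i))]
    simp [Real.sq_sqrt (hh _)]

/-- The chain rule for the entropy relative to the uniform measure. -/
theorem entUnif_prod {a : I → ℝ} {α : I → X → ℝ} (ha1 : ∑ i, a i = 1)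
    (hα1 : ∀ i, ∑ x, α i x = 1) :
    entUnif (fun y : I × X => a y.1 * α y.1 y.2) =
      entUnif a + ∑ i, a i * entUnif (α i) := by
  have hI := card_pos_of_sum_eq_one ha1
  unfold entUnif
  rw [Fintype.sum_prod_type, ← Finset.sum_add_distrib]
  refine Finset.sum_congr rfl fun i _ => ?_
  have hX := card_pos_of_sum_eq_one (hα1 i)
  rw [← mul_one (a i * Real.log _), ← hα1 i, Finset.mul_sum, Finset.mul_sum,
    ← Finset.sum_add_distrib]
  refine Finset.sum_congr rfl fun x _ => ?_
  by_cases h1 : a i = 0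
  · simp [h1]
  by_cases h2 : α i x = 0
  · simp [h2]
  have e : a i * α i x * (Fintype.card (I × X) : ℝ) =
      (a i * Fintype.card I) * (α i x * Fintype.card X) := by
    rw [Fintype.card_prod]; push_cast; ring
  rw [e, Real.log_mul (mul_ne_zero h1 hI.ne') (mul_ne_zero h2 hX.ne')]
  ring

theorem TransportEntropy.of_equiv {Y : Type*} [Fintype Y] (e : X ≃ Y) {r : ℕ} {d : Y → Y → ℝ}
    {C : ℝ} (h : TransportEntropy r X (fun x y => d (e x) (e y)) C) :
    TransportEntropy r Y d C := by
  intro ν hν hν1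
  have hc : (Fintype.card X : ℝ) = Fintype.card Y := by rw [Fintype.card_congr e]
  have hE : entUnif (ν ∘ e) = entUnif ν := by
    unfold entUnif
    rw [← e.sum_comp, hc]
    rfl
  have hU : unifDensity X = unifDensity Y ∘ e := by
    funext x
    simp [unifDensity, hc]
  have := h (ν ∘ e) (fun x => hν _) (by rw [← hν1]; exact e.sum_comp ν)
  rw [hE, hU] at this
  exact ⟨this.1.of_equiv e, this.2.of_equiv e⟩

/-- Tensorization: one more coordinate increases the constant by `stepConst r * L ^ 2`. -/
theorem TransportEntropy.prod {r : ℕ} (hr : r = 1 ∨ r = 2) {dX : X → X → ℝ}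
    {d : I × X → I × X → ℝ} (hd : ∀ y z, 0 ≤ d y z) (hd0 : ∀ y, d y y = 0)
    (hd' : ∀ x y z, d x z ≤ d x y + d y z) (hdX : ∀ i x x', d (i, x) (i, x') ≤ dX x x')
    {L : ℝ} (hL : 0 ≤ L) (hB : ∀ i j, ∃ b : X ≃ X, ∀ x, d (i, x) (j, b x) ≤ L)
    {C : ℝ} (hC : 0 ≤ C) (h : TransportEntropy r X dX C) :
    TransportEntropy r (I × X) d (C + stepConst r * L ^ 2) := by
  intro ν hν hν1
  have hcard := card_pos_of_sum_eq_one hν1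
  have hX : (0 : ℝ) < Fintype.card X := by
    rw [Fintype.card_prod] at hcard
    push_cast at hcard
    exact pos_of_mul_pos_right hcard (Nat.cast_nonneg _)
  set a : I → ℝ := fun i => ∑ x, ν (i, x) with ha_def
  have ha : ∀ i, 0 ≤ a i := fun i => Finset.sum_nonneg fun x _ => hν _
  have ha1 : ∑ i, a i = 1 := by rw [← hν1, Fintype.sum_prod_type]
  set α : I → X → ℝ := fun i x => if a i = 0 then unifDensity X x else ν (i, x) / a i with hα_def
  have hα : ∀ i x, 0 ≤ α i x := by
    intro i x
    have := ha i; have := hν (i, x)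
    simp only [hα_def, unifDensity]
    split_ifs <;> positivity
  have hα1 : ∀ i, ∑ x, α i x = 1 := by
    intro i
    by_cases h0 : a i = 0
    · simp [hα_def, h0, unifDensity, hX.ne']
    · simp only [hα_def, h0, if_false]
      rw [← Finset.sum_div]
      exact div_self h0
  have hνα : ν = fun y => a y.1 * α y.1 y.2 := by
    funext ⟨i, x⟩
    by_cases h0 : a i = 0
    · have := (Finset.sum_eq_zero_iff_of_nonneg (fun x _ => hν (i, x))).1 h0 x (Finset.mem_univ x)
      simp [h0, this]
    · simp only [hα_def, h0, if_false]
      field_simp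
  have hent : entUnif ν = entUnif a + ∑ i, a i * entUnif (α i) := by
    conv_lhs => rw [hνα]
    exact entUnif_prod ha1 hα1
  have hEa := entUnif_nonneg ha ha1
  have hEα : ∀ i, 0 ≤ entUnif (α i) := fun i => entUnif_nonneg (hα i) (hα1 i)
  have hS : 0 ≤ ∑ i, a i * entUnif (α i) :=
    Finset.sum_nonneg fun i _ => mul_nonneg (ha i) (hEα i)
  have hU : unifDensity (I × X) = fun y => unifDensity I y.1 * unifDensity X y.2 := by
    funext y
    simp [unifDensity, Fintype.card_prod, mul_comm]
  have hXu : (Fintype.card X : ℝ) * (Fintype.card X : ℝ)⁻¹ = 1 := mul_inv_cancel₀ hX.ne'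
  have hu : (0 : ℝ) ≤ (Fintype.card X : ℝ)⁻¹ := inv_nonneg.2 hX.le
  have hW : ∑ i, a i * √(C * entUnif (α i)) ^ r ≤ √(C * ∑ i, a i * entUnif (α i)) ^ r := by
    refine (sum_mul_sqrt_pow_le hr ha ha1 fun i => mul_nonneg hC (hEα i)).trans (le_of_eq ?_)
    rw [Finset.mul_sum]
    congr 3
    funext i
    ring
  have hbound : √(C * ∑ i, a i * entUnif (α i)) + L * √(stepConst r * entUnif a) ≤
      √((C + stepConst r * L ^ 2) * entUnif ν) := by
    have e : L * √(stepConst r * entUnif a) = √(stepConst r * L ^ 2 * entUnif a) := by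
      rw [show stepConst r * L ^ 2 * entUnif a = L ^ 2 * (stepConst r * entUnif a) by ring,
        Real.sqrt_mul (sq_nonneg L), Real.sqrt_sq hL]
    rw [e, hent, add_comm (entUnif a)]
    exact sqrt_mul_add_sqrt_mul_le hS hEa hC (mul_nonneg (stepConst_nonneg r) (sq_nonneg L))
  have hn1 : 0 ≤ √(C * ∑ i, a i * entUnif (α i)) := Real.sqrt_nonneg _
  have hn2 : 0 ≤ L * √(stepConst r * entUnif a) := mul_nonneg hL (Real.sqrt_nonneg _)
  constructor
  · have s1 : HasTransport r d ν (fun y => a y.1 * (Fintype.card X : ℝ)⁻¹)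
        (√(C * ∑ i, a i * entUnif (α i))) := by
      rw [hνα]
      exact HasTransport.fiber (β := fun _ => unifDensity X) hd hdX ha hα
        (fun i => (h (α i) (hα i) (hα1 i)).1) hW
    have s2 := HasTransport.base hr hd hd0 hL hB ha ha1 hu hXu (Or.inl ⟨rfl, rfl⟩)
    rw [hU]
    exact (s1.trans hr hd hd' hν hn1 hn2 s2).mono (add_nonneg hn1 hn2) hbound
  · have s1 : HasTransport r d (fun y => a y.1 * (Fintype.card X : ℝ)⁻¹) ν
        (√(C * ∑ i, a i * entUnif (α i))) := by
      rw [hνα]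
      exact HasTransport.fiber (α := fun _ => unifDensity X) hd hdX ha (fun _ _ => hu)
        (fun i => (h (α i) (hα i) (hα1 i)).2) hW
    have s2 := HasTransport.base hr hd hd0 hL hB ha ha1 hu hXu (Or.inr ⟨rfl, rfl⟩)
    have hun := unifDensity_pos ha1
    rw [hU]
    refine (HasTransport.trans hr hd hd' (fun y => mul_nonneg (hun y.1).le hu) hn2 hn1 s2
      s1).mono (add_nonneg hn2 hn1) ?_
    rw [add_comm]
    exact hbound

theorem TransportEntropy.of_unique [Unique X] {r : ℕ} (hr : r = 1 ∨ r = 2) {d : X → X → ℝ}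
    (hd0 : ∀ x, d x x = 0) : TransportEntropy r X d 0 := by
  have hr0 : r ≠ 0 := by rcases hr with rfl | rfl <;> norm_num
  intro ν _ hν1
  have hν : ν = fun _ => 1 := by
    funext x
    rw [Subsingleton.elim x default]
    simpa using hν1
  subst hν
  have hU : unifDensity X = fun _ => 1 := by funext x; simp [unifDensity]
  rw [hU]
  have : HasTransport r d (fun _ => 1) (fun _ => 1) (√(0 * entUnif fun _ : X => (1 : ℝ))) :=
    ⟨fun _ _ => 1, by simp, by simp, by simp, by simp [hd0, hr0]⟩
  exact ⟨this, this⟩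

end Transport

section Subtype

variable {X : Type*} [Fintype X] {S : X → Prop} [Fintype (Subtype S)]

theorem sum_eq_sum_subtype_of_eq_zero {f : X → ℝ} (hf : ∀ x, ¬ S x → f x = 0) :
    ∑ x, f x = ∑ x : Subtype S, f x := by
  rw [← Finset.sum_subtype (Finset.univ.filter S) (by simp)]
  exact (Finset.sum_filter_of_ne fun x _ hx => by_contra fun h => hx (hf x h)).symm

theorem HasTransport.of_subtype {r : ℕ} {d : X → X → ℝ}
    {α β : X → ℝ} (hα : ∀ x, ¬ S x → α x = 0) (hβ : ∀ x, ¬ S x → β x = 0) {w : ℝ}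
    (h : HasTransport r (fun x y : Subtype S => d x y) (fun x => α x) (fun x => β x) w) :
    HasTransport r d α β w := by
  obtain ⟨p, p0, p1, p2, p3⟩ := h
  let q : X → X → ℝ := fun x y =>
    if hx : S x then (if hy : S y then p ⟨x, hx⟩ ⟨y, hy⟩ else 0) else if x = y then 1 else 0
  have hq : ∀ x y : Subtype S, q x y = p x y := fun x y => by simp [q, x.2, y.2]
  have hq' : ∀ (x : Subtype S) (y : X), ¬ S y → q x y = 0 := fun x y hy => by simp [q, x.2, hy]
  refine ⟨q, fun x y => ?_, fun x => ?_, fun y => ?_, ?_⟩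
  · simp only [q]
    split_ifs
    exacts [p0 _ _, le_rfl, zero_le_one, le_rfl]
  · by_cases hx : S x
    · rw [sum_eq_sum_subtype_of_eq_zero (S := S) fun y hy => hq' ⟨x, hx⟩ y hy, ← p1 ⟨x, hx⟩]
      exact Finset.sum_congr rfl fun y _ => hq ⟨x, hx⟩ y
    · simp [q, hx]
  · rw [sum_eq_sum_subtype_of_eq_zero (S := S) fun x hx => by rw [hα x hx, zero_mul]]
    by_cases hy : S y
    · refine Eq.trans (Finset.sum_congr rfl fun x _ => ?_) (p2 ⟨y, hy⟩)
      rw [hq x ⟨y, hy⟩]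
    · rw [hβ y hy]
      exact Finset.sum_eq_zero fun x _ => by rw [hq' x y hy, mul_zero]
  · rw [sum_eq_sum_subtype_of_eq_zero (S := S) fun x hx => by rw [hα x hx, zero_mul]]
    refine le_trans (le_of_eq (Finset.sum_congr rfl fun x _ => ?_)) p3
    rw [sum_eq_sum_subtype_of_eq_zero (S := S) fun y hy => by rw [hq' x y hy, zero_mul]]
    simp only [hq]

end Subtype

section Perm

variable {n : ℕ}

theorem dH_nonneg (σ τ : Equiv.Perm (Fin n)) : 0 ≤ dH σ τ := Nat.cast_nonneg _

theorem dH_self (σ : Equiv.Perm (Fin n)) : dH σ σ = 0 := by simp [dH]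

theorem dH_triangle (σ τ υ : Equiv.Perm (Fin n)) : dH σ υ ≤ dH σ τ + dH τ υ := by
  unfold dH
  rw [← Nat.cast_add, Nat.cast_le]
  refine (Finset.card_le_card fun i hi => ?_).trans (Finset.card_union_le _ _)
  simp only [Finset.mem_union, Finset.mem_filter, Finset.mem_univ, true_and] at *
  by_contra! h
  exact hi (h.1.trans h.2)

theorem dH_mul_right (σ τ υ : Equiv.Perm (Fin n)) : dH (σ * υ) (τ * υ) = dH σ τ := by
  unfold dH
  congr 1
  exact Finset.card_equiv υ fun i => by
    rw [Finset.mem_filter, Finset.mem_filter]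
    simp

theorem dH_mul_left (σ τ : Equiv.Perm (Fin n)) : dH σ (σ * τ) = degree τ := by
  simp [dH, degree, eq_comm]

/-- The subgroup of elements of `G` fixing every index `≥ m`. -/
def fixTail (G : Subgroup (Equiv.Perm (Fin n))) (m : ℕ) : Subgroup (Equiv.Perm (Fin n)) where
  carrier := {σ | σ ∈ G ∧ ∀ i : Fin n, m ≤ i → σ i = i}
  mul_mem' := fun ha hb => ⟨G.mul_mem ha.1 hb.1, fun i hi => by
    rw [Equiv.Perm.mul_apply, hb.2 i hi, ha.2 i hi]⟩
  one_mem' := ⟨G.one_mem, fun _ _ => rfl⟩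
  inv_mem' := fun ha => ⟨G.inv_mem ha.1, fun i hi => by
    rw [Equiv.Perm.inv_eq_iff_eq, ha.2 i hi]⟩

variable {G : Subgroup (Equiv.Perm (Fin n))}

theorem fixTail_eq_self : fixTail G n = G := by
  ext σ
  exact ⟨fun h => h.1, fun h => ⟨h, fun i hi => absurd i.2 (by omega)⟩⟩

theorem fixTail_one_eq_bot : fixTail G 1 = ⊥ := by
  refine (Subgroup.eq_bot_iff_forall _).2 fun σ hσ => Equiv.ext fun i => ?_
  by_cases hi : 1 ≤ (i : ℕ)
  · exact hσ.2 i hi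
  · by_contra h
    have h1 : 1 ≤ (σ i : ℕ) := by
      by_contra h2
      exact h (Fin.ext (by simp; omega))
    exact h (σ.injective (hσ.2 (σ i) h1))

theorem mem_fixTail_iff {j : Fin n} {σ : Equiv.Perm (Fin n)} :
    σ ∈ fixTail G j ↔ σ ∈ fixTail G (j + 1) ∧ σ j = j := by
  refine ⟨fun h => ⟨⟨h.1, fun i hi => h.2 i (by omega)⟩, h.2 j le_rfl⟩,
    fun h => ⟨h.1.1, fun i hi => ?_⟩⟩
  rcases hi.eq_or_lt with h1 | h1
  · rw [← Fin.ext h1, h.2]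
  · exact h.1.2 i h1

theorem fixTail_succ_eq {j : Fin n} (h : Orb G j = {j}) : fixTail G (j + 1) = fixTail G j := by
  ext σ
  rw [mem_fixTail_iff]
  refine ⟨fun hσ => ⟨hσ, ?_⟩, fun hσ => hσ.1⟩
  have : σ j ∈ Orb G j := ⟨σ, hσ, rfl⟩
  simpa [h] using this

/-- Elements of `G_j` factor through the point mapped to `j`. -/
def orbitProdEquiv {j : Fin n} (s : Orb G j → Equiv.Perm (Fin n))
    (hs : ∀ i, s i ∈ fixTail G (j + 1)) (hsj : ∀ i, s i j = i) :
    Orb G j × fixTail G j ≃ fixTail G (j + 1) where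
  toFun y := ⟨y.2 * (s y.1)⁻¹, mul_mem (mem_fixTail_iff.1 y.2.2).1 (inv_mem (hs _))⟩
  invFun g :=
    (⟨(g : Equiv.Perm (Fin n))⁻¹ j, _, inv_mem g.2, rfl⟩,
      ⟨g * s ⟨(g : Equiv.Perm (Fin n))⁻¹ j, _, inv_mem g.2, rfl⟩,
        mem_fixTail_iff.2 ⟨mul_mem g.2 (hs _), by simp [hsj]⟩⟩)
  left_inv := by
    rintro ⟨i, h⟩
    have hj : (h : Equiv.Perm (Fin n))⁻¹ j = j := by
      rw [Equiv.Perm.inv_eq_iff_eq, (mem_fixTail_iff.1 h.2).2]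
    have hi : (⟨((h : Equiv.Perm (Fin n)) * (s i)⁻¹)⁻¹ j,
        _, inv_mem (mul_mem (mem_fixTail_iff.1 h.2).1 (inv_mem (hs i))), rfl⟩ : Orb G j) = i := by
      apply Subtype.ext
      change (((h : Equiv.Perm (Fin n)) * (s i)⁻¹)⁻¹) j = i
      rw [mul_inv_rev, inv_inv, Equiv.Perm.mul_apply, hj, hsj]
    refine Prod.ext hi (Subtype.ext ?_)
    change (h : Equiv.Perm (Fin n)) * (s i)⁻¹ * s _ = h
    rw [hi]
    simp
  right_inv g := by
    apply Subtype.ext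
    simp

theorem transportEntropy_fixTail_succ {ℓ : ℕ} (hG : IsLLocal ℓ G) {r : ℕ} (hr : r = 1 ∨ r = 2)
    {j : Fin n} {C : ℝ} (hC : 0 ≤ C)
    (h : TransportEntropy r (fixTail G j) (fun σ τ => dH (σ : Equiv.Perm (Fin n)) τ) C) :
    TransportEntropy r (fixTail G (j + 1)) (fun σ τ => dH (σ : Equiv.Perm (Fin n)) τ)
      (C + stepConst r * (ℓ : ℝ) ^ 2) := by
  choose s hs hsj using fun i : Orb G j => i.2
  refine TransportEntropy.of_equiv (orbitProdEquiv s hs hsj) ?_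
  refine TransportEntropy.prod hr ?_ ?_ ?_ ?_ (Nat.cast_nonneg ℓ) ?_ hC h
  · exact fun _ _ => dH_nonneg _ _
  · exact fun _ => dH_self _
  · exact fun _ _ _ => dH_triangle _ _ _
  · exact fun i x x' => (dH_mul_right _ _ _).le
  intro i i'
  have hσ : s i * (s i')⁻¹ ∈ fixTail G (j + 1) := mul_mem (hs i) (inv_mem (hs i'))
  have hσi : (s i * (s i')⁻¹) i' = i := by
    have hinv : (s i')⁻¹ i' = j := by rw [Equiv.Perm.inv_eq_iff_eq, hsj]
    rw [Equiv.Perm.mul_apply, hinv, hsj]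
  obtain ⟨τ, hτG, hτσ, hτℓ, hτi⟩ := hG _ hσ.1 i' i hσi
  have hτ : τ ∈ fixTail G (j + 1) := ⟨hτG, fun x hx => by
    by_contra hne
    exact hτσ hne (hσ.2 x hx)⟩
  have hk : (s i)⁻¹ * τ * s i' ∈ fixTail G j :=
    mem_fixTail_iff.2 ⟨mul_mem (mul_mem (inv_mem (hs i)) hτ) (hs i'), by
      rw [Equiv.Perm.mul_apply, Equiv.Perm.mul_apply, hsj, hτi, Equiv.Perm.inv_eq_iff_eq, hsj]⟩
  refine ⟨Equiv.mulRight ⟨_, hk⟩, fun x => ?_⟩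
  change dH ((x : Equiv.Perm (Fin n)) * (s i)⁻¹)
    ((x : Equiv.Perm (Fin n)) * ((s i)⁻¹ * τ * s i') * (s i')⁻¹) ≤ ℓ
  rw [show (x : Equiv.Perm (Fin n)) * ((s i)⁻¹ * τ * s i') * (s i')⁻¹ =
    (x : Equiv.Perm (Fin n)) * (s i)⁻¹ * τ by group, dH_mul_left]
  exact_mod_cast hτℓ

theorem transportEntropy_fixTail {ℓ : ℕ} (hG : IsLLocal ℓ G) {r : ℕ} (hr : r = 1 ∨ r = 2)
    {m : ℕ} (hm : 1 ≤ m) (hmn : m ≤ n) :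
    TransportEntropy r (fixTail G m) (fun σ τ => dH (σ : Equiv.Perm (Fin n)) τ)
      (((Finset.univ.filter fun j : Fin n =>
        (j : ℕ) < m ∧ (j : ℕ) ≠ 0 ∧ Orb G j ≠ {j}).card : ℝ) * (stepConst r * (ℓ : ℝ) ^ 2)) := by
  induction m, hm using Nat.le_induction with
  | base =>
    have : (Finset.univ.filter fun j : Fin n =>
        (j : ℕ) < 1 ∧ (j : ℕ) ≠ 0 ∧ Orb G j ≠ {j}) = ∅ :=
      Finset.filter_eq_empty_iff.2 fun j _ => by omega
    rw [this, fixTail_one_eq_bot]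
    simp only [Finset.card_empty, Nat.cast_zero, zero_mul]
    convert TransportEntropy.of_unique (X := (⊥ : Subgroup (Equiv.Perm (Fin n)))) hr
      (d := fun σ τ => dH (σ : Equiv.Perm (Fin n)) τ) fun _ => dH_self _
  | succ m hm ih =>
    have ih := ih (by omega)
    let j : Fin n := ⟨m, hmn⟩
    have hj0 : (j : ℕ) ≠ 0 := by change m ≠ 0; omega
    by_cases hO : Orb G j = {j}
    · have e : (Finset.univ.filter fun i : Fin n =>
          (i : ℕ) < m + 1 ∧ (i : ℕ) ≠ 0 ∧ Orb G i ≠ {i}) =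
          Finset.univ.filter fun i : Fin n => (i : ℕ) < m ∧ (i : ℕ) ≠ 0 ∧ Orb G i ≠ {i} := by
        refine Finset.filter_congr fun i _ => ⟨fun h => ⟨?_, h.2⟩, fun h => ⟨by omega, h.2⟩⟩
        by_contra hi
        have : i = j := Fin.ext (by change (i : ℕ) = m; omega)
        exact h.2.2 (this ▸ hO)
      have e' : fixTail G (m + 1) = fixTail G m := fixTail_succ_eq hO
      rw [e, e']
      exact ih
    · have e : (Finset.univ.filter fun i : Fin n =>
          (i : ℕ) < m + 1 ∧ (i : ℕ) ≠ 0 ∧ Orb G i ≠ {i}) =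
          insert j (Finset.univ.filter fun i : Fin n =>
            (i : ℕ) < m ∧ (i : ℕ) ≠ 0 ∧ Orb G i ≠ {i}) := by
        ext i
        simp only [Finset.mem_insert, Finset.mem_filter, Finset.mem_univ, true_and]
        constructor
        · rintro ⟨h1, h2⟩
          by_cases hi : (i : ℕ) < m
          · exact Or.inr ⟨hi, h2⟩
          · exact Or.inl (Fin.ext (by change (i : ℕ) = m; omega))
        · rintro (rfl | ⟨h1, h2⟩)
          · exact ⟨by change m < m + 1; omega, hj0, hO⟩
          · exact ⟨by omega, h2⟩
      rw [e, Finset.card_insert_of_notMem (by simp [j])]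
      push_cast
      rw [add_mul, one_mul]
      exact transportEntropy_fixTail_succ hG hr (j := j)
        (mul_nonneg (Nat.cast_nonneg _) (mul_nonneg (stepConst_nonneg r) (sq_nonneg _))) ih

/-- The uniform measure on an `ℓ`-local group satisfies the transport-entropy inequality. -/
theorem transportEntropy_of_isLLocal (hn : 1 ≤ n) {ℓ : ℕ} (hG : IsLLocal ℓ G) {r : ℕ}
    (hr : r = 1 ∨ r = 2) :
    TransportEntropy r G (fun σ τ => dH (σ : Equiv.Perm (Fin n)) τ)
      ((Kn G : ℝ) * (stepConst r * (ℓ : ℝ) ^ 2)) := by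
  have h := transportEntropy_fixTail hG hr hn le_rfl
  rw [fixTail_eq_self] at h
  simpa [Kn] using h

theorem relEnt_unif {ν : Equiv.Perm (Fin n) → ℝ} (hν : IsProbOn ν (G : Set (Equiv.Perm (Fin n)))) :
    relEnt ν (unif G) = ENNReal.ofReal (entUnif fun σ : G => ν σ) := by
  have hac : ∀ x, unif G x = 0 → ν x = 0 := by
    intro x hx
    refine hν.2.1 x fun hxG => ?_
    have hxG' : x ∈ G := hxG
    simp [unif, hxG'] at hx
  rw [relEnt, if_pos hac, entUnif]
  congr 1
  rw [sum_eq_sum_subtype_of_eq_zero (S := fun σ => σ ∈ G) fun x hx => by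
    rw [hν.2.1 x hx, zero_mul]]
  refine Finset.sum_congr rfl fun x _ => ?_
  have hx : (x : Equiv.Perm (Fin n)) ∈ G := x.2
  rw [unif, if_pos hx, div_inv_eq_mul, Nat.card_eq_fintype_card]

theorem hasTransport_of_isLLocal (hn : 1 ≤ n) {ℓ : ℕ} (hG : IsLLocal ℓ G) {r : ℕ}
    (hr : r = 1 ∨ r = 2) {ν₁ ν₂ : Equiv.Perm (Fin n) → ℝ}
    (hν₁ : IsProbOn ν₁ (G : Set (Equiv.Perm (Fin n))))
    (hν₂ : IsProbOn ν₂ (G : Set (Equiv.Perm (Fin n)))) :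
    HasTransport r dH ν₁ ν₂
      (√((Kn G : ℝ) * (stepConst r * (ℓ : ℝ) ^ 2) * entUnif fun σ : G => ν₁ σ) +
        √((Kn G : ℝ) * (stepConst r * (ℓ : ℝ) ^ 2) * entUnif fun σ : G => ν₂ σ)) := by
  have hT := transportEntropy_of_isLLocal hn hG hr
  have hsum : ∀ {ν : Equiv.Perm (Fin n) → ℝ}, IsProbOn ν (G : Set (Equiv.Perm (Fin n))) →
      ∑ σ : G, ν σ = 1 := fun hν => by
    rw [← hν.2.2, sum_eq_sum_subtype_of_eq_zero (S := fun σ => σ ∈ G) fun x hx => hν.2.1 x hx]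
  refine HasTransport.of_subtype (S := fun σ => σ ∈ G)
    (fun x hx => hν₁.2.1 x hx) (fun x hx => hν₂.2.1 x hx) ?_
  exact HasTransport.trans hr (d := fun σ τ : G => dH (σ : Equiv.Perm (Fin n)) τ)
    (fun _ _ => dH_nonneg _ _) (fun _ _ _ => dH_triangle _ _ _)
    (fun x => hν₁.1 x) (Real.sqrt_nonneg _) (Real.sqrt_nonneg _)
    (hT _ (fun x => hν₁.1 x) (hsum hν₁)).1 (hT _ (fun x => hν₂.1 x) (hsum hν₂)).2

end Perm

section Cost

variable {X : Type*} [Fintype X] {d : X → X → ℝ} {α β : X → ℝ} {w : ℝ}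

theorem W1_nonneg (hd : ∀ x y, 0 ≤ d x y) : 0 ≤ W1 d α β := by
  refine Real.sInf_nonneg ?_
  rintro _ ⟨π, h0, -, -, rfl⟩
  exact Finset.sum_nonneg fun q _ => mul_nonneg (hd _ _) (h0 q)

theorem W1_le_of_hasTransport (hd : ∀ x y, 0 ≤ d x y) (hα : ∀ x, 0 ≤ α x)
    (h : HasTransport 1 d α β w) : W1 d α β ≤ w := by
  obtain ⟨p, p0, p1, p2, p3⟩ := h
  simp only [pow_one] at p3
  refine le_trans (csInf_le ⟨0, ?_⟩ ⟨fun q => α q.1 * p q.1 q.2,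
    fun q => mul_nonneg (hα _) (p0 _ _), fun x => ?_, p2, rfl⟩) (le_trans (le_of_eq ?_) p3)
  · rintro _ ⟨π, h0, -, -, rfl⟩
    exact Finset.sum_nonneg fun q _ => mul_nonneg (hd _ _) (h0 q)
  · dsimp only
    rw [← Finset.mul_sum, p1, mul_one]
  · rw [Fintype.sum_prod_type]
    refine Finset.sum_congr rfl fun x _ => ?_
    rw [Finset.mul_sum]
    exact Finset.sum_congr rfl fun y _ => by ring

theorem tT2_le_of_hasTransport (hα : ∀ x, 0 ≤ α x) (h : HasTransport 2 d α β w) :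
    tT2 d α β ≤ w ^ 2 := by
  obtain ⟨p, p0, p1, p2, p3⟩ := h
  refine le_trans (csInf_le ⟨0, ?_⟩ ⟨p, p0, p1, p2, rfl⟩) p3
  rintro _ ⟨p, -, -, -, rfl⟩
  exact Finset.sum_nonneg fun x _ => mul_nonneg (hα x) (sq_nonneg _)

theorem ofReal_le_mul_rpow_add_sq {t C A B : ℝ} (hC : 0 ≤ C) (hA : 0 ≤ A) (hB : 0 ≤ B)
    (h : t ≤ (√(C * A) + √(C * B)) ^ 2) :
    ENNReal.ofReal t ≤ ENNReal.ofReal C *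
      (ENNReal.ofReal A ^ ((1 : ℝ) / 2) + ENNReal.ofReal B ^ ((1 : ℝ) / 2)) ^ 2 := by
  rw [ENNReal.ofReal_rpow_of_nonneg hA (by norm_num), ENNReal.ofReal_rpow_of_nonneg hB (by norm_num),
    ← Real.sqrt_eq_rpow, ← Real.sqrt_eq_rpow,
    ← ENNReal.ofReal_add (Real.sqrt_nonneg _) (Real.sqrt_nonneg _),
    ← ENNReal.ofReal_pow (add_nonneg (Real.sqrt_nonneg _) (Real.sqrt_nonneg _)),
    ← ENNReal.ofReal_mul hC]
  refine ENNReal.ofReal_le_ofReal (h.trans (le_of_eq ?_))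
  rw [Real.sqrt_mul hC, Real.sqrt_mul hC, ← mul_add, mul_pow, Real.sq_sqrt hC]

end Cost

/-- Transport-entropy inequalities for the uniform measure on an `ℓ`-local group,
with the improved constant `c = ℓ`. -/
theorem stmt6 {n ℓ : ℕ} (hn : 2 ≤ n) (hℓ : 2 ≤ ℓ) (hℓn : ℓ ≤ n)
    (G : Subgroup (Equiv.Perm (Fin n))) (hG : IsLLocal ℓ G)
    (ν₁ ν₂ : Equiv.Perm (Fin n) → ℝ)
    (hν₁ : IsProbOn ν₁ (G : Set (Equiv.Perm (Fin n))))
    (hν₂ : IsProbOn ν₂ (G : Set (Equiv.Perm (Fin n)))) :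
    ENNReal.ofReal (W1 dH ν₁ ν₂ ^ 2) ≤
      ENNReal.ofReal ((ℓ : ℝ) ^ 2 * (Kn G : ℝ) / 2) *
        (relEnt ν₁ (unif G) ^ ((1 : ℝ) / 2) + relEnt ν₂ (unif G) ^ ((1 : ℝ) / 2)) ^ 2 ∧
    ENNReal.ofReal (tT2 dH ν₁ ν₂) ≤
      ENNReal.ofReal (2 * (ℓ : ℝ) ^ 2 * (Kn G : ℝ)) *
        (relEnt ν₁ (unif G) ^ ((1 : ℝ) / 2) + relEnt ν₂ (unif G) ^ ((1 : ℝ) / 2)) ^ 2 := by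
  have hn1 : 1 ≤ n := by omega
  have hE : ∀ {ν : Equiv.Perm (Fin n) → ℝ}, IsProbOn ν (G : Set (Equiv.Perm (Fin n))) →
      0 ≤ entUnif fun σ : G => ν σ := fun {ν} hν => by
    refine entUnif_nonneg (fun σ => hν.1 σ) ?_
    rw [← hν.2.2, sum_eq_sum_subtype_of_eq_zero (S := fun σ => σ ∈ G) fun x hx => hν.2.1 x hx]
  have h1 := hasTransport_of_isLLocal hn1 hG (r := 1) (Or.inl rfl) hν₁ hν₂
  have h2 := hasTransport_of_isLLocal hn1 hG (r := 2) (Or.inr rfl) hν₁ hν₂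
  rw [show (Kn G : ℝ) * (stepConst 1 * (ℓ : ℝ) ^ 2) = (ℓ : ℝ) ^ 2 * (Kn G : ℝ) / 2 by
    simp [stepConst]; ring] at h1
  rw [show (Kn G : ℝ) * (stepConst 2 * (ℓ : ℝ) ^ 2) = 2 * (ℓ : ℝ) ^ 2 * (Kn G : ℝ) by
    simp [stepConst]; ring] at h2
  rw [relEnt_unif hν₁, relEnt_unif hν₂]
  exact ⟨ofReal_le_mul_rpow_add_sq (by positivity) (hE hν₁) (hE hν₂)
      (pow_le_pow_left₀ (W1_nonneg dH_nonneg) (W1_le_of_hasTransport dH_nonneg hν₁.1 h1) 2),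
    ofReal_le_mul_rpow_add_sq (by positivity) (hE hν₁) (hE hν₂)
      (tT2_le_of_hasTransport hν₁.1 h2)⟩

end
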